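/- For every α ∈ (1,2], there exists exactly one probability measure γ on [1,∞) that is a fixed point of the α-recursive distributional equation; that is, exactly one probability measure γ on [1,∞) such that γ is the law of (U + (1−U)/(X₁+⋯+X_N))^{−1} when U is uniform on [0,1], N is distributed according to θ_α, and (X_i)_{i≥1} are i.i.d. with law γ, all independent. -/

import Mathlib

open MeasureTheory

/-- The α-offspring distribution: θ_α(k) = α(2−α)(3−α)⋯(k−1−α)/k! for k ≥ 2, and 0 else. -/
noncomputable def thetaDist (α : ℝ) (k : ℕ) : ℝ :=
  if 2 ≤ k then α * (∏ i ∈ Finset.Icc 2 (k - 1), ((i : ℝ) - α)) / (Nat.factorial k : ℝ) else 0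

/-- The uniform distribution on [0,1]. -/
noncomputable def unifMeasure : Measure ℝ := volume.restrict (Set.Icc 0 1)

/-- The map on measures associated with the α-recursive distributional equation:
the law of G(U,N,(X₁,…,X_N)) = (U + (1−U)/(X₁+⋯+X_N))⁻¹ where U is uniform on [0,1],
N ~ θ_α and the X_i are i.i.d. with law γ, all independent (decomposed according to
the value of N). -/
noncomputable def rdeMap (α : ℝ) (γ : Measure ℝ) : Measure ℝ :=
  Measure.sum fun k : ℕ =>
    ENNReal.ofReal (thetaDist α k) •
      Measure.map (fun p : ℝ × (Fin k → ℝ) => (p.1 + (1 - p.1) / ∑ i, p.2 i)⁻¹)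
        (unifMeasure.prod (Measure.pi fun _ : Fin k => γ))

/-- γ is a probability measure on [1,∞) that is a fixed point of the α-recursive
distributional equation. -/
def IsRDEFixedPoint (α : ℝ) (γ : Measure ℝ) : Prop :=
  IsProbabilityMeasure γ ∧ γ (Set.Iio 1) = 0 ∧ rdeMap α γ = γ

open Filter Topology
open scoped ENNReal NNReal

/-! ### The offspring distribution -/

/-- The tail `∑_{k > n} θ_α(k)` of the offspring distribution, for `n ≥ 1`. -/
noncomputable def thetaTail (α : ℝ) (n : ℕ) : ℝ :=
  (∏ i ∈ Finset.Icc 2 n, ((i : ℝ) - α)) / (Nat.factorial n : ℝ)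

lemma thetaTail_succ (α : ℝ) (n : ℕ) :
    thetaTail α (n + 2) = thetaTail α (n + 1) * ((n + 2 : ℝ) - α) / (n + 2) := by
  have h : (Nat.factorial (n + 1) : ℝ) ≠ 0 := by positivity
  have h2 : (n + 2 : ℝ) ≠ 0 := by positivity
  unfold thetaTail
  rw [Finset.prod_Icc_succ_top (by omega), Nat.factorial_succ (n + 1)]
  push_cast
  field_simp
  ring

lemma thetaDist_add_two (α : ℝ) (n : ℕ) :
    thetaDist α (n + 2) = α * thetaTail α (n + 1) / (n + 2) := by
  have h : (Nat.factorial (n + 1) : ℝ) ≠ 0 := by positivity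
  have h2 : (n + 2 : ℝ) ≠ 0 := by positivity
  unfold thetaDist thetaTail
  rw [if_pos (by omega), Nat.factorial_succ (n + 1)]
  simp only [Nat.add_succ_sub_one]
  push_cast
  field_simp
  ring

lemma thetaTail_one (α : ℝ) : thetaTail α 1 = 1 := by
  simp [thetaTail]

lemma thetaTail_nonneg {α : ℝ} (hα : α ≤ 2) (n : ℕ) : 0 ≤ thetaTail α n := by
  refine div_nonneg (Finset.prod_nonneg fun i hi => ?_) (by positivity)
  have : (2 : ℝ) ≤ i := by exact_mod_cast (Finset.mem_Icc.1 hi).1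
  linarith

lemma thetaTail_succ_le {α : ℝ} (hα : α ∈ Set.Ioc (1 : ℝ) 2) (n : ℕ) :
    thetaTail α (n + 1) ≤ 1 / (n + 1) := by
  induction n with
  | zero => simp [thetaTail_one]
  | succ n ih =>
    have h2 : (0 : ℝ) < n + 2 := by positivity
    rw [thetaTail_succ]
    push_cast
    rw [add_assoc, one_add_one_eq_two]
    gcongr
    have hn : (0 : ℝ) ≤ n := by positivity
    calc thetaTail α (n + 1) * ((n + 2 : ℝ) - α) ≤ 1 / (n + 1) * ((n + 2 : ℝ) - α) := by
          gcongr
          linarith [hα.2]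
      _ ≤ 1 / (n + 1) * (n + 1) := by
          gcongr
          linarith [hα.1]
      _ = 1 := by field_simp

lemma thetaDist_nonneg {α : ℝ} (hα : α ∈ Set.Ioc (1 : ℝ) 2) (k : ℕ) : 0 ≤ thetaDist α k := by
  rcases k with _ | _ | n
  · simp [thetaDist]
  · simp [thetaDist]
  · rw [thetaDist_add_two]
    have := thetaTail_nonneg hα.2 (n + 1)
    have := hα.1
    positivity

lemma thetaDist_of_lt_two (α : ℝ) {k : ℕ} (hk : k < 2) : thetaDist α k = 0 := by
  simp [thetaDist, not_le.2 hk]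

lemma thetaDist_two (α : ℝ) : thetaDist α 2 = α / 2 := by
  simp [thetaDist]

lemma hasSum_thetaDist {α : ℝ} (hα : α ∈ Set.Ioc (1 : ℝ) 2) : HasSum (thetaDist α) 1 := by
  rw [← hasSum_nat_add_iff' 2]
  simp only [Finset.sum_range_succ, Finset.sum_range_zero,
    thetaDist_of_lt_two α (show 0 < 2 by norm_num), thetaDist_of_lt_two α (show 1 < 2 by norm_num)]
  rw [hasSum_iff_tendsto_nat_of_nonneg fun n => thetaDist_nonneg hα _]
  have hsum (n : ℕ) : ∑ i ∈ Finset.range n, thetaDist α (i + 2) = 1 - thetaTail α (n + 1) := by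
    induction n with
    | zero => simp [thetaTail_one]
    | succ n ih =>
      have h2 : (n + 2 : ℝ) ≠ 0 := by positivity
      rw [Finset.sum_range_succ, ih, thetaDist_add_two, thetaTail_succ]
      field_simp
      ring
  simp only [hsum]
  have : Tendsto (fun n => thetaTail α (n + 1)) atTop (𝓝 0) :=
    squeeze_zero (fun n => thetaTail_nonneg hα.2 _) (thetaTail_succ_le hα)
      tendsto_one_div_add_atTop_nhds_zero_nat
  simpa using this.const_sub 1

lemma summable_thetaDist_mul {α : ℝ} (hα : α ∈ Set.Ioc (1 : ℝ) 2) :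
    Summable fun k : ℕ => thetaDist α k * k := by
  rw [← summable_nat_add_iff 2]
  have h1 : 0 < α - 1 := by linarith [hα.1]
  have hsum (n : ℕ) : ∑ i ∈ Finset.range n, thetaDist α (i + 2) * ((i + 2 : ℕ) : ℝ)
      = α / (α - 1) * (1 - thetaTail α (n + 1) * (n + 1)) := by
    induction n with
    | zero => simp [thetaTail_one]
    | succ n ih =>
      have h2 : (n + 2 : ℝ) ≠ 0 := by positivity
      rw [Finset.sum_range_succ, ih, thetaDist_add_two, thetaTail_succ]
      push_cast
      field_simp
      ring
  refine summable_of_sum_range_le (c := α / (α - 1))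
    (fun n => mul_nonneg (thetaDist_nonneg hα _) (by positivity)) fun n => ?_
  rw [hsum]
  have h3 : 0 ≤ thetaTail α (n + 1) * (n + 1) :=
    mul_nonneg (thetaTail_nonneg hα.2 _) (by positivity)
  have h4 : 0 ≤ α / (α - 1) := div_nonneg (by linarith) h1.le
  nlinarith

lemma tsum_ofReal_thetaDist {α : ℝ} (hα : α ∈ Set.Ioc (1 : ℝ) 2) :
    ∑' k, ENNReal.ofReal (thetaDist α k) = 1 := by
  rw [← ENNReal.ofReal_tsum_of_nonneg (thetaDist_nonneg hα) (hasSum_thetaDist hα).summable,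
    (hasSum_thetaDist hα).tsum_eq, ENNReal.ofReal_one]

lemma tsum_ofReal_thetaDist_mul_ne_top {α : ℝ} (hα : α ∈ Set.Ioc (1 : ℝ) 2) :
    ∑' k : ℕ, ENNReal.ofReal (thetaDist α k) * k ≠ ∞ := by
  have (k : ℕ) : ENNReal.ofReal (thetaDist α k) * k = ENNReal.ofReal (thetaDist α k * k) := by
    rw [ENNReal.ofReal_mul (thetaDist_nonneg hα k), ENNReal.ofReal_natCast]
  simp only [this]
  exact (summable_thetaDist_mul hα).tsum_ofReal_ne_top

/-! ### The recursion function -/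

/-- The recursion function, as a function of the uniform variable and of the sum. -/
noncomputable def rdeFun (u s : ℝ) : ℝ := (u + (1 - u) / s)⁻¹

lemma rdeFun_eq {u s : ℝ} (hs : 1 ≤ s) : rdeFun u s = s / (1 + u * (s - 1)) := by
  have : s ≠ 0 := by positivity
  rw [rdeFun, show u + (1 - u) / s = (1 + u * (s - 1)) / s by field_simp; ring, inv_div]

lemma one_le_rdeFun {u s : ℝ} (hu : u ∈ Set.Icc (0 : ℝ) 1) (hs : 1 ≤ s) : 1 ≤ rdeFun u s := by
  have h : 0 ≤ u * (s - 1) := mul_nonneg hu.1 (by linarith)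
  rw [rdeFun_eq hs, le_div_iff₀ (by linarith)]
  nlinarith [hu.2]

lemma rdeFun_le_self {u s : ℝ} (hu : u ∈ Set.Icc (0 : ℝ) 1) (hs : 1 ≤ s) : rdeFun u s ≤ s := by
  have h : 0 ≤ u * (s - 1) := mul_nonneg hu.1 (by linarith)
  rw [rdeFun_eq hs]
  exact div_le_self (by linarith) (by linarith)

lemma rdeFun_le_inv {u s : ℝ} (hu : u ∈ Set.Ioc (0 : ℝ) 1) (hs : 1 ≤ s) : rdeFun u s ≤ u⁻¹ := by
  have : 0 ≤ (1 - u) / s := div_nonneg (by linarith [hu.2]) (by linarith)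
  exact inv_anti₀ hu.1 (by linarith)

lemma one_add_mul_pos {u a : ℝ} (hu : u ∈ Set.Icc (0 : ℝ) 1) (ha : 1 ≤ a) :
    0 < 1 + u * (a - 1) := by
  nlinarith [mul_nonneg hu.1 (sub_nonneg.2 ha)]

lemma abs_rdeFun_sub_le {u a s t : ℝ} (hu : u ∈ Set.Icc (0 : ℝ) 1) (ha : 1 ≤ a) (hs : a ≤ s)
    (ht : a ≤ t) :
    |rdeFun u s - rdeFun u t| ≤ (1 - u) / (1 + u * (a - 1)) ^ 2 * |s - t| := by
  have h1 := one_add_mul_pos hu ha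
  have hs' : 1 + u * (a - 1) ≤ 1 + u * (s - 1) := by nlinarith [hu.1]
  have ht' : 1 + u * (a - 1) ≤ 1 + u * (t - 1) := by nlinarith [hu.1]
  have h2 : 0 < 1 + u * (s - 1) := by linarith
  have h3 : 0 < 1 + u * (t - 1) := by linarith
  have h4 : 0 ≤ 1 - u := by linarith [hu.2]
  rw [rdeFun_eq (ha.trans hs), rdeFun_eq (ha.trans ht),
    show s / (1 + u * (s - 1)) - t / (1 + u * (t - 1))
      = (1 - u) / ((1 + u * (s - 1)) * (1 + u * (t - 1))) * (s - t) by field_simp; ring,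
    abs_mul, abs_of_nonneg (by positivity), sq]
  gcongr

/-- The Lipschitz constant on `[a, ∞)` of the expectation of `rdeFun U s`. -/
noncomputable def rdeLip (a : ℝ) : ℝ := ∫ u, (1 - u) / (1 + u * (a - 1)) ^ 2 ∂unifMeasure

instance : IsProbabilityMeasure unifMeasure :=
  ⟨by simp [unifMeasure]⟩

lemma ae_unifMeasure_mem : ∀ᵐ u ∂unifMeasure, u ∈ Set.Icc (0 : ℝ) 1 :=
  ae_restrict_mem measurableSet_Icc

lemma ae_unifMeasure_mem_Ioc : ∀ᵐ u ∂unifMeasure, u ∈ Set.Ioc (0 : ℝ) 1 := by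
  rw [unifMeasure, ← restrict_Ioc_eq_restrict_Icc]
  exact ae_restrict_mem measurableSet_Ioc

lemma integral_unifMeasure (f : ℝ → ℝ) : ∫ u, f u ∂unifMeasure = ∫ u in (0 : ℝ)..1, f u := by
  rw [unifMeasure, integral_Icc_eq_integral_Ioc, intervalIntegral.integral_of_le zero_le_one]

lemma integrable_unifMeasure_div {a : ℝ} (ha : 1 ≤ a) {f : ℝ → ℝ} (hf : Continuous f) :
    Integrable (fun u => f u / (1 + u * (a - 1)) ^ 2) unifMeasure := by
  refine ContinuousOn.integrableOn_compact isCompact_Icc ?_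
  refine hf.continuousOn.div (by fun_prop) fun u hu => ?_
  have := one_add_mul_pos hu ha
  positivity

lemma integral_one_div_sq {a : ℝ} (ha : 1 ≤ a) :
    ∫ u, 1 / (1 + u * (a - 1)) ^ 2 ∂unifMeasure = 1 / a := by
  rw [integral_unifMeasure]
  rw [intervalIntegral.integral_eq_sub_of_hasDerivAt (f := fun u => u / (1 + u * (a - 1)))]
  · norm_num
  · intro u hu
    rw [Set.uIcc_of_le zero_le_one] at hu
    have h := one_add_mul_pos hu ha
    have hd : HasDerivAt (fun u : ℝ => 1 + u * (a - 1)) (a - 1) u := by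
      simpa using ((hasDerivAt_id u).mul_const (a - 1)).const_add 1
    have hq := (hasDerivAt_id u).div hd h.ne'
    rwa [id, one_mul, add_sub_cancel_right] at hq
  · have := integrable_unifMeasure_div ha (f := fun _ => 1) continuous_const
    rw [unifMeasure, ← restrict_Ioc_eq_restrict_Icc] at this
    exact (intervalIntegrable_iff_integrableOn_Ioc_of_le zero_le_one).2 this

lemma rdeLip_nonneg {a : ℝ} : 0 ≤ rdeLip a := by
  refine integral_nonneg_of_ae ?_
  filter_upwards [ae_unifMeasure_mem] with u hu
  exact div_nonneg (by linarith [hu.2]) (by positivity)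

lemma rdeLip_le {a : ℝ} (ha : 1 ≤ a) : rdeLip a ≤ 1 / a := by
  rw [← integral_one_div_sq ha]
  refine integral_mono_ae (integrable_unifMeasure_div ha (by fun_prop))
    (integrable_unifMeasure_div ha (by fun_prop)) ?_
  filter_upwards [ae_unifMeasure_mem] with u hu
  gcongr
  linarith [hu.1]

lemma rdeLip_two_le : rdeLip 2 ≤ 3 / 8 := by
  have hint : Integrable (fun u : ℝ => u / 4) unifMeasure :=
    ContinuousOn.integrableOn_compact isCompact_Icc (by fun_prop)
  have hint' := integrable_unifMeasure_div (a := 2) (by norm_num) (f := fun _ => 1) (by fun_prop)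
  calc rdeLip 2 ≤ ∫ u, (1 / (1 + u * (2 - 1)) ^ 2 - u / 4) ∂unifMeasure := by
        refine integral_mono_ae (integrable_unifMeasure_div (by norm_num) (by fun_prop))
          (hint'.sub hint) ?_
        filter_upwards [ae_unifMeasure_mem] with u hu
        have h := hu.1
        have h1 : u / 4 ≤ u / (1 + u * (2 - 1)) ^ 2 := by
          gcongr
          nlinarith [hu.2]
        rw [sub_div]
        linarith
    _ = 3 / 8 := by
        rw [integral_sub hint' hint, integral_one_div_sq (by norm_num), integral_unifMeasure]
        simp
        norm_num

/-- The expectation of `N * rdeLip N` is strictly less than one. -/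
lemma tsum_thetaDist_mul_rdeLip_le {α : ℝ} (hα : α ∈ Set.Ioc (1 : ℝ) 2) :
    Summable (fun k : ℕ => thetaDist α k * (k * rdeLip k)) ∧
      ∑' k : ℕ, thetaDist α k * (k * rdeLip k) ≤ 1 - α / 8 := by
  have hle (k : ℕ) : thetaDist α k * (k * rdeLip k)
      ≤ thetaDist α k - if k = 2 then α / 8 else 0 := by
    rcases lt_or_ge k 2 with hk | hk
    · simp [thetaDist_of_lt_two α hk, hk.ne]
    rcases hk.eq_or_lt with rfl | hk'
    · have := rdeLip_two_le
      have := hα.1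
      simp only [thetaDist_two, if_true]
      push_cast
      nlinarith
    · have h1 : (1 : ℝ) ≤ k := by exact_mod_cast (by omega : 1 ≤ k)
      have h2 : (k : ℝ) * rdeLip k ≤ 1 := by
        have := rdeLip_le h1
        rw [le_div_iff₀ (by linarith)] at this
        linarith
      simp only [hk'.ne', if_false, sub_zero]
      exact mul_le_of_le_one_right (thetaDist_nonneg hα k) h2
  have hs := (hasSum_thetaDist hα).sub (hasSum_ite_eq 2 (α / 8))
  have hsum : Summable (fun k : ℕ => thetaDist α k * (k * rdeLip k)) :=
    Summable.of_nonneg_of_le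
      (fun k => mul_nonneg (thetaDist_nonneg hα k) (mul_nonneg k.cast_nonneg rdeLip_nonneg))
      hle hs.summable
  exact ⟨hsum, (hsum.tsum_le_tsum hle hs.summable).trans_eq hs.tsum_eq⟩

/-! ### A dual form of the Wasserstein distance -/

/-- Bounded functions with Lipschitz constant `L`. -/
structure IsBddLip (L : ℝ) (f : ℝ → ℝ) : Prop where
  abs_sub_le : ∀ x y, |f x - f y| ≤ L * |x - y|
  bounded : ∃ M, ∀ x, |f x| ≤ M

lemma IsBddLip.nonneg {L : ℝ} {f : ℝ → ℝ} (hf : IsBddLip L f) : 0 ≤ L := by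
  simpa using (abs_nonneg _).trans (hf.abs_sub_le 1 0)

lemma IsBddLip.continuous {L : ℝ} {f : ℝ → ℝ} (hf : IsBddLip L f) : Continuous f :=
  (LipschitzWith.of_dist_le_mul (K := ⟨L, hf.nonneg⟩) fun x y => by
    exact hf.abs_sub_le x y).continuous

lemma IsBddLip.integrable_comp {L : ℝ} {f : ℝ → ℝ} (hf : IsBddLip L f) {Ω : Type*}
    [MeasurableSpace Ω] {μ : Measure Ω} [IsFiniteMeasure μ] {g : Ω → ℝ} (hg : Measurable g) :
    Integrable (fun x => f (g x)) μ := by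
  obtain ⟨M, hM⟩ := hf.bounded
  exact Integrable.of_bound (hf.continuous.measurable.comp hg).aestronglyMeasurable M
    (ae_of_all _ fun x => hM _)

lemma abs_integral_le_of_ae_abs_le {Ω : Type*} [MeasurableSpace Ω] {μ : Measure Ω}
    [IsProbabilityMeasure μ] {f : Ω → ℝ} {M : ℝ} (h : ∀ᵐ x ∂μ, |f x| ≤ M) :
    |∫ x, f x ∂μ| ≤ M := by
  simpa using norm_integral_le_of_norm_le_const (f := f) h

/-- The Wasserstein distance between `μ` and `ν`, in its dual form, is at most `D`. -/
def WassersteinLE (μ ν : Measure ℝ) (D : ℝ) : Prop :=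
  ∀ L f, IsBddLip L f → |∫ x, f x ∂μ - ∫ x, f x ∂ν| ≤ L * D

lemma IsBddLip.integral_add {L : ℝ} {f : ℝ → ℝ} (hf : IsBddLip L f) (μ : Measure ℝ)
    [IsProbabilityMeasure μ] : IsBddLip L fun s => ∫ x, f (x + s) ∂μ where
  abs_sub_le s t := by
    rw [← integral_sub (hf.integrable_comp (by fun_prop)) (hf.integrable_comp (by fun_prop))]
    exact abs_integral_le_of_ae_abs_le
      (ae_of_all _ fun x => by simpa using hf.abs_sub_le (x + s) (x + t))
  bounded := by
    obtain ⟨M, hM⟩ := hf.bounded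
    exact ⟨M, fun s => abs_integral_le_of_ae_abs_le (ae_of_all _ fun x => hM _)⟩

lemma IsBddLip.integral_pi_sum_succ {L : ℝ} {f : ℝ → ℝ} (hf : IsBddLip L f) (μ : Measure ℝ)
    [IsProbabilityMeasure μ] (k : ℕ) :
    ∫ x, f (∑ i, x i) ∂(Measure.pi fun _ : Fin (k + 1) => μ)
      = ∫ y, ∫ x, f (x + ∑ i, y i) ∂μ ∂(Measure.pi fun _ : Fin k => μ) := by
  have h := (measurePreserving_piFinSuccAbove (fun _ : Fin (k + 1) => μ) 0).integral_comp'
    (fun p : ℝ × (Fin k → ℝ) => f (p.1 + ∑ i, p.2 i))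
  rw [integral_prod_symm _ (hf.integrable_comp (by fun_prop))] at h
  rw [← h]
  simp [Fin.sum_univ_succ, MeasurableEquiv.piFinSuccAbove, Fin.insertNthEquiv, Fin.tail]

lemma WassersteinLE.pi_sum {μ ν : Measure ℝ} [IsProbabilityMeasure μ] [IsProbabilityMeasure ν]
    {D : ℝ} (h : WassersteinLE μ ν D) (k : ℕ) {L : ℝ} {f : ℝ → ℝ} (hf : IsBddLip L f) :
    |∫ x, f (∑ i, x i) ∂(Measure.pi fun _ : Fin k => μ)
      - ∫ x, f (∑ i, x i) ∂(Measure.pi fun _ : Fin k => ν)| ≤ k * (L * D) := by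
  induction k generalizing f with
  | zero => simp
  | succ k ih =>
    rw [hf.integral_pi_sum_succ, hf.integral_pi_sum_succ]
    have h1 := ih (hf.integral_add μ)
    have h2 : |∫ y, ∫ x, f (x + ∑ i, y i) ∂μ ∂(Measure.pi fun _ : Fin k => ν)
        - ∫ y, ∫ x, f (x + ∑ i, y i) ∂ν ∂(Measure.pi fun _ : Fin k => ν)| ≤ L * D := by
      rw [← integral_sub ((hf.integral_add μ).integrable_comp (by fun_prop))
        ((hf.integral_add ν).integrable_comp (by fun_prop))]
      refine abs_integral_le_of_ae_abs_le (ae_of_all _ fun y => ?_)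
      refine h L (fun x => f (x + ∑ i, y i)) ⟨fun x x' => ?_, ?_⟩
      · simpa using hf.abs_sub_le (x + ∑ i, y i) (x' + ∑ i, y i)
      · obtain ⟨M, hM⟩ := hf.bounded
        exact ⟨M, fun x => hM _⟩
    calc _ ≤ _ := abs_sub_le _ (∫ y, ∫ x, f (x + ∑ i, y i) ∂μ ∂(Measure.pi fun _ : Fin k => ν)) _
      _ ≤ k * (L * D) + L * D := add_le_add h1 h2
      _ = _ := by push_cast; ring

/-! ### The map on measures -/

lemma ae_one_le {γ : Measure ℝ} (h1 : γ (Set.Iio 1) = 0) : ∀ᵐ x ∂γ, 1 ≤ x := by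
  rw [ae_iff]
  simpa [Set.Iio] using h1

lemma ae_one_le_pi {γ : Measure ℝ} [IsProbabilityMeasure γ] (h1 : γ (Set.Iio 1) = 0) (k : ℕ) :
    ∀ᵐ x ∂(Measure.pi fun _ : Fin k => γ), ∀ i, 1 ≤ x i :=
  ae_all_iff.2 fun i =>
    (measurePreserving_eval (fun _ : Fin k => γ) i).quasiMeasurePreserving.ae (ae_one_le h1)

lemma card_le_sum {k : ℕ} {x : Fin k → ℝ} (hx : ∀ i, 1 ≤ x i) : (k : ℝ) ≤ ∑ i, x i := by
  simpa using Finset.sum_le_sum (s := Finset.univ) fun i _ => hx i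

lemma ae_card_le_sum {γ : Measure ℝ} [IsProbabilityMeasure γ] (h1 : γ (Set.Iio 1) = 0) (k : ℕ) :
    ∀ᵐ x ∂(Measure.pi fun _ : Fin k => γ), (k : ℝ) ≤ ∑ i, x i := by
  filter_upwards [ae_one_le_pi h1 k] with x hx using card_le_sum hx

lemma measurable_rdeFun_sum (k : ℕ) :
    Measurable fun p : ℝ × (Fin k → ℝ) => rdeFun p.1 (∑ i, p.2 i) := by
  unfold rdeFun
  fun_prop

lemma rdeMap_eq (α : ℝ) (γ : Measure ℝ) :
    rdeMap α γ = Measure.sum fun k : ℕ => ENNReal.ofReal (thetaDist α k) •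
      Measure.map (fun p : ℝ × (Fin k → ℝ) => rdeFun p.1 (∑ i, p.2 i))
        (unifMeasure.prod (Measure.pi fun _ : Fin k => γ)) := rfl

lemma isProbabilityMeasure_rdeMap {α : ℝ} (hα : α ∈ Set.Ioc (1 : ℝ) 2) (γ : Measure ℝ)
    [IsProbabilityMeasure γ] : IsProbabilityMeasure (rdeMap α γ) := by
  refine ⟨?_⟩
  rw [rdeMap_eq, Measure.sum_apply _ MeasurableSet.univ, ← tsum_ofReal_thetaDist hα]
  congr 1 with k
  simp [Measure.map_apply (measurable_rdeFun_sum k) MeasurableSet.univ]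

lemma lintegral_rdeMap {α : ℝ} {γ : Measure ℝ} [IsProbabilityMeasure γ] {f : ℝ → ℝ≥0∞}
    (hf : Measurable f) :
    ∫⁻ x, f x ∂(rdeMap α γ) = ∑' k : ℕ, ENNReal.ofReal (thetaDist α k) *
      ∫⁻ p, f (rdeFun p.1 (∑ i, p.2 i)) ∂(unifMeasure.prod (Measure.pi fun _ : Fin k => γ)) := by
  simp_rw [rdeMap_eq, lintegral_sum_measure, lintegral_smul_measure,
    lintegral_map hf (measurable_rdeFun_sum _), smul_eq_mul]

lemma ae_prod_unifMeasure_pi {γ : Measure ℝ} [IsProbabilityMeasure γ] (h1 : γ (Set.Iio 1) = 0)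
    (k : ℕ) : ∀ᵐ p ∂(unifMeasure.prod (Measure.pi fun _ : Fin k => γ)),
      p.1 ∈ Set.Ioc (0 : ℝ) 1 ∧ ∀ i, 1 ≤ p.2 i := by
  filter_upwards [Measure.quasiMeasurePreserving_fst.ae ae_unifMeasure_mem_Ioc,
    Measure.quasiMeasurePreserving_snd.ae (ae_one_le_pi h1 k)] with p h h' using ⟨h, h'⟩

lemma rdeMap_Iio_one {α : ℝ} {γ : Measure ℝ} [IsProbabilityMeasure γ]
    (h1 : γ (Set.Iio 1) = 0) : rdeMap α γ (Set.Iio 1) = 0 := by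
  rw [rdeMap_eq, Measure.sum_apply _ measurableSet_Iio, ENNReal.tsum_eq_zero]
  intro k
  rcases lt_or_ge k 2 with hk | hk
  · simp [thetaDist_of_lt_two α hk]
  rw [Measure.smul_apply, Measure.map_apply (measurable_rdeFun_sum k) measurableSet_Iio]
  refine smul_eq_zero_of_right _ ?_
  rw [measure_eq_zero_iff_ae_notMem]
  filter_upwards [ae_prod_unifMeasure_pi h1 k] with p hp
  simp only [Set.mem_preimage, Set.mem_Iio, not_lt]
  have h2 : (1 : ℝ) ≤ k := by exact_mod_cast (by omega : 1 ≤ k)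
  exact one_le_rdeFun ⟨hp.1.1.le, hp.1.2⟩ (h2.trans (card_le_sum hp.2))

/-- The expectation of `f (rdeFun U s)`, made constant for `s` below `a`. -/
noncomputable def rdeMean (f : ℝ → ℝ) (a s : ℝ) : ℝ :=
  ∫ u, f (rdeFun u (max s a)) ∂unifMeasure

lemma measurable_rdeFun_left (s : ℝ) : Measurable fun u => rdeFun u s := by
  unfold rdeFun
  fun_prop

lemma IsBddLip.rdeMean {L : ℝ} {f : ℝ → ℝ} (hf : IsBddLip L f) {a : ℝ} (ha : 1 ≤ a) :
    IsBddLip (L * rdeLip a) (rdeMean f a) where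
  abs_sub_le s t := by
    unfold _root_.rdeMean rdeLip
    rw [← integral_sub (hf.integrable_comp (measurable_rdeFun_left _))
      (hf.integrable_comp (measurable_rdeFun_left _)), mul_assoc, ← integral_mul_const,
      ← integral_const_mul]
    refine norm_integral_le_of_norm_le (f := fun u => f (rdeFun u (max s a))
      - f (rdeFun u (max t a))) (((integrable_unifMeasure_div ha
      (f := fun u => 1 - u) (by fun_prop)).mul_const _).const_mul _) ?_
    filter_upwards [ae_unifMeasure_mem] with u hu
    refine (hf.abs_sub_le _ _).trans (mul_le_mul_of_nonneg_left ?_ hf.nonneg)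
    refine (abs_rdeFun_sub_le hu ha (le_max_right _ _) (le_max_right _ _)).trans ?_
    refine mul_le_mul_of_nonneg_left ?_ (div_nonneg (by linarith [hu.2]) (by positivity))
    simpa using abs_max_sub_max_le_max s a t a
  bounded := by
    obtain ⟨M, hM⟩ := hf.bounded
    exact ⟨M, fun s => abs_integral_le_of_ae_abs_le (ae_of_all _ fun x => hM _)⟩

lemma IsBddLip.hasSum_integral_rdeMap {α : ℝ} (hα : α ∈ Set.Ioc (1 : ℝ) 2) {γ : Measure ℝ}
    [IsProbabilityMeasure γ] (h1 : γ (Set.Iio 1) = 0) {L : ℝ} {f : ℝ → ℝ} (hf : IsBddLip L f) :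
    HasSum (fun k : ℕ => thetaDist α k *
        ∫ x, _root_.rdeMean f k (∑ i, x i) ∂(Measure.pi fun _ : Fin k => γ))
      (∫ x, f x ∂(rdeMap α γ)) := by
  have := isProbabilityMeasure_rdeMap hα γ
  have hint : Integrable f (rdeMap α γ) := hf.integrable_comp measurable_id
  have h := hasSum_integral_measure (rdeMap_eq α γ ▸ hint)
  rw [← rdeMap_eq] at h
  refine h.congr_fun fun k => ?_
  rw [integral_smul_measure, ENNReal.toReal_ofReal (thetaDist_nonneg hα k), smul_eq_mul,
    integral_map (measurable_rdeFun_sum k).aemeasurable hf.continuous.aestronglyMeasurable,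
    integral_prod_symm _ (hf.integrable_comp (measurable_rdeFun_sum k))]
  congr 1
  refine integral_congr_ae ?_
  filter_upwards [ae_card_le_sum h1 k] with x hx
  simp [_root_.rdeMean, max_eq_left hx]

/-- The map of the recursive distributional equation is a contraction. -/
lemma WassersteinLE.rdeMap {α : ℝ} (hα : α ∈ Set.Ioc (1 : ℝ) 2) {μ ν : Measure ℝ}
    [IsProbabilityMeasure μ] [IsProbabilityMeasure ν] (hμ : μ (Set.Iio 1) = 0)
    (hν : ν (Set.Iio 1) = 0) {D : ℝ} (hD : 0 ≤ D) (h : WassersteinLE μ ν D) :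
    WassersteinLE (rdeMap α μ) (rdeMap α ν) ((1 - α / 8) * D) := by
  intro L f hf
  have hs := (hf.hasSum_integral_rdeMap hα hμ).sub (hf.hasSum_integral_rdeMap hα hν)
  obtain ⟨hsum, hle⟩ := tsum_thetaDist_mul_rdeLip_le hα
  have hbound (k : ℕ) : ‖thetaDist α k *
        ∫ x, rdeMean f k (∑ i, x i) ∂(Measure.pi fun _ : Fin k => μ) - thetaDist α k *
        ∫ x, rdeMean f k (∑ i, x i) ∂(Measure.pi fun _ : Fin k => ν)‖
      ≤ thetaDist α k * (k * rdeLip k) * (L * D) := by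
    rcases lt_or_ge k 2 with hk | hk
    · simp [thetaDist_of_lt_two α hk]
    have h2 : (1 : ℝ) ≤ k := by exact_mod_cast (by omega : 1 ≤ k)
    rw [← mul_sub, norm_mul, Real.norm_of_nonneg (thetaDist_nonneg hα k), mul_assoc]
    refine mul_le_mul_of_nonneg_left ((h.pi_sum k (hf.rdeMean h2)).trans_eq ?_)
      (thetaDist_nonneg hα k)
    ring
  rw [← hs.tsum_eq]
  calc _ ≤ _ := tsum_of_norm_bounded (hsum.mul_right (L * D)).hasSum hbound
    _ = (∑' k : ℕ, thetaDist α k * (k * rdeLip k)) * (L * D) := tsum_mul_right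
    _ ≤ (1 - α / 8) * (L * D) := by
        have := hf.nonneg
        gcongr
    _ = _ := by ring

/-! ### Moments -/

lemma lintegral_inv_sqrt_unifMeasure_ne_top :
    ∫⁻ u, ENNReal.ofReal (√u)⁻¹ ∂unifMeasure ≠ ∞ := by
  have h : IntervalIntegrable (fun u : ℝ => u ^ (-(1 / 2) : ℝ)) volume 0 1 :=
    intervalIntegral.intervalIntegrable_rpow' (by norm_num)
  rw [intervalIntegrable_iff_integrableOn_Ioc_of_le zero_le_one, IntegrableOn,
    restrict_Ioc_eq_restrict_Icc] at h
  refine ne_of_eq_of_ne (lintegral_congr_ae ?_) h.lintegral_lt_top.ne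
  filter_upwards [ae_unifMeasure_mem] with u hu
  rw [Real.rpow_neg hu.1, Real.sqrt_eq_rpow]

lemma lintegral_sqrt_rdeMap_le {α : ℝ} (hα : α ∈ Set.Ioc (1 : ℝ) 2) {γ : Measure ℝ}
    [IsProbabilityMeasure γ] (h1 : γ (Set.Iio 1) = 0) :
    ∫⁻ x, ENNReal.ofReal √x ∂(rdeMap α γ) ≤ ∫⁻ u, ENNReal.ofReal (√u)⁻¹ ∂unifMeasure := by
  rw [lintegral_rdeMap (by fun_prop)]
  calc _ ≤ ∑' k : ℕ, ENNReal.ofReal (thetaDist α k) *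
        ∫⁻ u, ENNReal.ofReal (√u)⁻¹ ∂unifMeasure := by
        refine ENNReal.tsum_le_tsum fun k => ?_
        rcases lt_or_ge k 2 with hk | hk
        · simp [thetaDist_of_lt_two α hk]
        gcongr
        calc _ ≤ ∫⁻ p, ENNReal.ofReal (√p.1)⁻¹
              ∂(unifMeasure.prod (Measure.pi fun _ : Fin k => γ)) := by
              refine lintegral_mono_ae ?_
              filter_upwards [ae_prod_unifMeasure_pi h1 k] with p hp
              have h2 : (1 : ℝ) ≤ k := by exact_mod_cast (by omega : 1 ≤ k)
              rw [← Real.sqrt_inv]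
              exact ENNReal.ofReal_le_ofReal (Real.sqrt_le_sqrt
                (rdeFun_le_inv hp.1 (h2.trans (card_le_sum hp.2))))
          _ = _ := by
              rw [lintegral_prod _ (by fun_prop)]
              simp
    _ = _ := by rw [ENNReal.tsum_mul_right, tsum_ofReal_thetaDist hα, one_mul]

lemma sqrt_add_le_add_sqrt (x y : ℝ) : √(x + y) ≤ √x + √y := by
  refine Real.sqrt_le_iff.2 ⟨by positivity, ?_⟩
  have h (z : ℝ) : z ≤ √z ^ 2 := (Real.sqrt_le_left (Real.sqrt_nonneg z)).1 le_rfl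
  nlinarith [h x, h y, mul_nonneg (Real.sqrt_nonneg x) (Real.sqrt_nonneg y)]

lemma sqrt_sum_le {ι : Type*} (s : Finset ι) (x : ι → ℝ) :
    √(∑ i ∈ s, x i) ≤ ∑ i ∈ s, √(x i) := by
  classical
  induction s using Finset.induction_on with
  | empty => simp
  | insert i s hi ih =>
    rw [Finset.sum_insert hi, Finset.sum_insert hi]
    exact (sqrt_add_le_add_sqrt _ _).trans (by gcongr)

lemma lintegral_sqrt_sum_pi_le (γ : Measure ℝ) [IsProbabilityMeasure γ] (k : ℕ) :
    ∫⁻ x, ENNReal.ofReal √(∑ i, x i) ∂(Measure.pi fun _ : Fin k => γ)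
      ≤ k * ∫⁻ x, ENNReal.ofReal √x ∂γ := by
  calc _ ≤ ∫⁻ x, ∑ i, ENNReal.ofReal √(x i) ∂(Measure.pi fun _ : Fin k => γ) := by
        refine lintegral_mono fun x => ?_
        rw [← ENNReal.ofReal_sum_of_nonneg fun i _ => Real.sqrt_nonneg _]
        exact ENNReal.ofReal_le_ofReal (sqrt_sum_le _ _)
    _ = ∑ i : Fin k, ∫⁻ x, ENNReal.ofReal √x ∂γ := by
        rw [lintegral_finsetSum _ fun i _ => by fun_prop]
        refine Finset.sum_congr rfl fun i _ => ?_
        exact (measurePreserving_eval (fun _ : Fin k => γ) i).lintegral_comp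
          (f := fun x => ENNReal.ofReal √x) (by fun_prop)
    _ = _ := by simp

lemma lintegral_rdeMap_ne_top {α : ℝ} (hα : α ∈ Set.Ioc (1 : ℝ) 2) {γ : Measure ℝ}
    [IsProbabilityMeasure γ] (h1 : γ (Set.Iio 1) = 0)
    (hγ : ∫⁻ x, ENNReal.ofReal √x ∂γ ≠ ∞) :
    ∫⁻ x, ENNReal.ofReal x ∂(rdeMap α γ) ≠ ∞ := by
  rw [lintegral_rdeMap (by fun_prop)]
  set C := ∫⁻ u, ENNReal.ofReal (√u)⁻¹ ∂unifMeasure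
  set m := ∫⁻ x, ENNReal.ofReal √x ∂γ
  have key : ∑' k : ℕ, ENNReal.ofReal (thetaDist α k) *
        ∫⁻ p, ENNReal.ofReal (rdeFun p.1 (∑ i, p.2 i))
          ∂(unifMeasure.prod (Measure.pi fun _ : Fin k => γ))
      ≤ ∑' k : ℕ, ENNReal.ofReal (thetaDist α k) * k * (C * m) := by
    refine ENNReal.tsum_le_tsum fun k => ?_
    rcases lt_or_ge k 2 with hk | hk
    · simp [thetaDist_of_lt_two α hk]
    rw [mul_assoc]
    gcongr
    calc _ ≤ ∫⁻ p, ENNReal.ofReal (√p.1)⁻¹ * ENNReal.ofReal √(∑ i, p.2 i)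
          ∂(unifMeasure.prod (Measure.pi fun _ : Fin k => γ)) := by
          refine lintegral_mono_ae ?_
          filter_upwards [ae_prod_unifMeasure_pi h1 k] with p hp
          have h2 : (1 : ℝ) ≤ k := by exact_mod_cast (by omega : 1 ≤ k)
          have hs := h2.trans (card_le_sum hp.2)
          rw [← ENNReal.ofReal_mul (by positivity), ← Real.sqrt_inv]
          refine ENNReal.ofReal_le_ofReal ?_
          have h3 := one_le_rdeFun ⟨hp.1.1.le, hp.1.2⟩ hs
          rw [← Real.mul_self_sqrt (show 0 ≤ rdeFun p.1 (∑ i, p.2 i) by linarith)]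
          gcongr
          · exact rdeFun_le_inv hp.1 hs
          · exact rdeFun_le_self ⟨hp.1.1.le, hp.1.2⟩ hs
      _ = C * ∫⁻ x, ENNReal.ofReal √(∑ i, x i) ∂(Measure.pi fun _ : Fin k => γ) :=
          lintegral_prod_mul (f := fun u : ℝ => ENNReal.ofReal (√u)⁻¹)
            (g := fun x : Fin k → ℝ => ENNReal.ofReal √(∑ i, x i)) (by fun_prop) (by fun_prop)
      _ ≤ C * (k * m) := by
          gcongr
          exact lintegral_sqrt_sum_pi_le γ k
      _ = _ := by ring
  refine ne_top_of_le_ne_top ?_ key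
  rw [ENNReal.tsum_mul_right]
  exact ENNReal.mul_ne_top (tsum_ofReal_thetaDist_mul_ne_top hα)
    (ENNReal.mul_ne_top lintegral_inv_sqrt_unifMeasure_ne_top hγ)

/-! ### Convergence -/

lemma exists_wassersteinLE {μ ν : Measure ℝ} [IsProbabilityMeasure μ] [IsProbabilityMeasure ν]
    (hμ : μ (Set.Iio 1) = 0) (hν : ν (Set.Iio 1) = 0)
    (hμ' : ∫⁻ x, ENNReal.ofReal x ∂μ ≠ ∞) (hν' : ∫⁻ x, ENNReal.ofReal x ∂ν ≠ ∞) :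
    ∃ D, 0 ≤ D ∧ WassersteinLE μ ν D := by
  have key {γ : Measure ℝ} [IsProbabilityMeasure γ] (h1 : γ (Set.Iio 1) = 0)
      (h : ∫⁻ x, ENNReal.ofReal x ∂γ ≠ ∞) : ∃ C, 0 ≤ C ∧
        ∀ L f, IsBddLip L f → |∫ x, f x ∂γ - f 0| ≤ L * C := by
    have hpos : ∀ᵐ x ∂γ, 0 ≤ x := by
      filter_upwards [ae_one_le h1] with x hx using zero_le_one.trans hx
    have hint : Integrable (fun x : ℝ => x) γ :=
      (lintegral_ofReal_ne_top_iff_integrable (by fun_prop) hpos).1 h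
    refine ⟨∫ x, x ∂γ, integral_nonneg_of_ae hpos, fun L f hf => ?_⟩
    have hsub : ∫ x, f x ∂γ - f 0 = ∫ x, (f x - f 0) ∂γ := by
      have hfi : Integrable f γ := hf.integrable_comp measurable_id
      rw [integral_sub hfi (integrable_const _)]
      simp
    rw [hsub, ← integral_const_mul]
    refine norm_integral_le_of_norm_le (f := fun x => f x - f 0) (hint.const_mul L) ?_
    filter_upwards [hpos] with x hx
    simpa [abs_of_nonneg hx] using hf.abs_sub_le x 0
  obtain ⟨C, hC, h⟩ := key hμ hμ'
  obtain ⟨C', hC', h'⟩ := key hν hν'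
  refine ⟨C + C', by positivity, fun L f hf => ?_⟩
  have h2 := h' L f hf
  rw [abs_sub_comm] at h2
  linarith [abs_sub_le (∫ x, f x ∂μ) (f 0) (∫ x, f x ∂ν), h L f hf]

lemma eq_of_integral_isBddLip_eq {μ ν : Measure ℝ} [IsProbabilityMeasure μ]
    [IsProbabilityMeasure ν] (h : ∀ L f, IsBddLip L f → ∫ x, f x ∂μ = ∫ x, f x ∂ν) : μ = ν := by
  let P : ProbabilityMeasure ℝ := ⟨μ, inferInstance⟩
  let Q : ProbabilityMeasure ℝ := ⟨ν, inferInstance⟩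
  have : Tendsto (fun _ : ℕ => P) atTop (𝓝 Q) := by
    rw [tendsto_iff_forall_lipschitz_integral_tendsto]
    rintro f ⟨M, hM⟩ ⟨K, hK⟩
    have hf : IsBddLip K f := ⟨fun x y => hK.dist_le_mul x y, |f 0| + M, fun x => ?_⟩
    · simp only [P, Q, ProbabilityMeasure.coe_mk, h K f hf, tendsto_const_nhds]
    · have h1 := hM x 0
      rw [Real.dist_eq] at h1
      linarith [abs_sub_abs_le_abs_sub (f x) (f 0)]
  have hPQ : P = Q := tendsto_nhds_unique tendsto_const_nhds this
  exact congrArg Subtype.val hPQ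

lemma contraction_nonneg {α : ℝ} (hα : α ∈ Set.Ioc (1 : ℝ) 2) : 0 ≤ 1 - α / 8 := by
  linarith [hα.2]

lemma contraction_lt_one {α : ℝ} (hα : α ∈ Set.Ioc (1 : ℝ) 2) : 1 - α / 8 < 1 := by
  linarith [hα.1]

lemma IsRDEFixedPoint.eq {α : ℝ} (hα : α ∈ Set.Ioc (1 : ℝ) 2) {μ ν : Measure ℝ}
    (hμ : IsRDEFixedPoint α μ) (hν : IsRDEFixedPoint α ν) : μ = ν := by
  have key {γ : Measure ℝ} (h : IsRDEFixedPoint α γ) : ∫⁻ x, ENNReal.ofReal x ∂γ ≠ ∞ := by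
    obtain ⟨_, h1, h2⟩ := h
    rw [← h2]
    refine lintegral_rdeMap_ne_top hα h1
      (ne_top_of_le_ne_top lintegral_inv_sqrt_unifMeasure_ne_top ?_)
    nth_rewrite 1 [← h2]
    exact lintegral_sqrt_rdeMap_le hα h1
  have hμ' := key hμ
  have hν' := key hν
  obtain ⟨_, h1, h2⟩ := hμ
  obtain ⟨_, h1', h2'⟩ := hν
  obtain ⟨D, hD, h⟩ := exists_wassersteinLE h1 h1' hμ' hν'
  have hc := contraction_nonneg hα
  have hpow (n : ℕ) : WassersteinLE μ ν ((1 - α / 8) ^ n * D) := by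
    induction n with
    | zero => simpa using h
    | succ n ih =>
      have := ih.rdeMap hα h1 h1' (by positivity)
      rwa [h2, h2', ← mul_assoc, ← pow_succ'] at this
  refine eq_of_integral_isBddLip_eq fun L f hf => ?_
  have hlim : Tendsto (fun n : ℕ => L * ((1 - α / 8) ^ n * D)) atTop (𝓝 0) := by
    simpa using ((tendsto_pow_atTop_nhds_zero_of_lt_one hc
      (contraction_lt_one hα)).mul_const D).const_mul L
  have := ge_of_tendsto' hlim fun n => hpow n L f hf
  exact sub_eq_zero.1 (abs_nonpos_iff.1 this)

/-- The iterates of the map of the recursive distributional equation, started from `δ₁`. -/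
noncomputable def rdeIter (α : ℝ) (n : ℕ) : Measure ℝ := (rdeMap α)^[n] (Measure.dirac 1)

lemma rdeIter_succ (α : ℝ) (n : ℕ) : rdeIter α (n + 1) = rdeMap α (rdeIter α n) :=
  Function.iterate_succ_apply' _ _ _

lemma rdeIter_spec {α : ℝ} (hα : α ∈ Set.Ioc (1 : ℝ) 2) (n : ℕ) :
    IsProbabilityMeasure (rdeIter α n) ∧ rdeIter α n (Set.Iio 1) = 0 ∧
      ∫⁻ x, ENNReal.ofReal √x ∂(rdeIter α n)
        ≤ 1 + ∫⁻ u, ENNReal.ofReal (√u)⁻¹ ∂unifMeasure := by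
  induction n with
  | zero =>
    refine ⟨inferInstanceAs (IsProbabilityMeasure (Measure.dirac 1)), by simp [rdeIter], ?_⟩
    simp [rdeIter]
  | succ n ih =>
    obtain ⟨_, h1, -⟩ := ih
    rw [rdeIter_succ]
    exact ⟨isProbabilityMeasure_rdeMap hα _, rdeMap_Iio_one h1,
      (lintegral_sqrt_rdeMap_le hα h1).trans le_add_self⟩

lemma exists_wassersteinLE_rdeIter {α : ℝ} (hα : α ∈ Set.Ioc (1 : ℝ) 2) :
    ∃ D, 0 ≤ D ∧ ∀ n m, n ≤ m →
      WassersteinLE (rdeIter α n) (rdeIter α m) ((1 - α / 8) ^ n * D) := by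
  have hc := contraction_nonneg hα
  have h0 : ∫⁻ x, ENNReal.ofReal √x ∂(Measure.dirac (1 : ℝ)) ≠ ∞ := by simp
  have h1 : ∫⁻ x, ENNReal.ofReal x ∂(rdeMap α (Measure.dirac 1)) ≠ ∞ :=
    lintegral_rdeMap_ne_top hα (by simp) h0
  have := isProbabilityMeasure_rdeMap hα (Measure.dirac 1)
  obtain ⟨D, hD, h⟩ := exists_wassersteinLE (μ := Measure.dirac 1) (ν := rdeMap α (Measure.dirac 1))
    (by simp) (rdeMap_Iio_one (by simp)) (by simp) h1
  have hsucc (n : ℕ) : WassersteinLE (rdeIter α n) (rdeIter α (n + 1)) ((1 - α / 8) ^ n * D) := by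
    induction n with
    | zero => simpa [rdeIter] using h
    | succ n ih =>
      obtain ⟨_, h1, -⟩ := rdeIter_spec hα n
      obtain ⟨_, h1', -⟩ := rdeIter_spec hα (n + 1)
      have := ih.rdeMap hα h1 h1' (by positivity)
      rwa [← rdeIter_succ, ← rdeIter_succ, ← mul_assoc, ← pow_succ'] at this
  have hα0 : 0 < α := by linarith [hα.1]
  refine ⟨D * (8 / α), by positivity, fun n m hnm L f hf => ?_⟩
  have hL := hf.nonneg
  have hstrong : |∫ x, f x ∂(rdeIter α n) - ∫ x, f x ∂(rdeIter α m)|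
      ≤ L * (((1 - α / 8) ^ n - (1 - α / 8) ^ m) * (D * (8 / α))) := by
    induction m, hnm using Nat.le_induction with
    | base => simp
    | succ m hnm ih =>
      refine (abs_sub_le _ (∫ x, f x ∂(rdeIter α m)) _).trans
        ((add_le_add ih (hsucc m L f hf)).trans_eq ?_)
      field_simp
      ring
  refine hstrong.trans ?_
  gcongr
  exact sub_le_self _ (by positivity)

lemma measure_compl_Icc_le {γ : Measure ℝ} (h1 : γ (Set.Iio 1) = 0) {C : ℝ≥0∞}
    (hC : ∫⁻ x, ENNReal.ofReal √x ∂γ ≤ C) (n : ℕ) :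
    γ (Set.Icc 1 (((n : ℝ) + 1) ^ 2))ᶜ ≤ C / (n + 1 : ℕ) := by
  have hsub : (Set.Icc (1 : ℝ) (((n : ℝ) + 1) ^ 2))ᶜ
      ⊆ Set.Iio 1 ∪ {x | ((n + 1 : ℕ) : ℝ≥0∞) ≤ ENNReal.ofReal √x} := by
    intro x hx
    simp only [Set.mem_compl_iff, Set.mem_Icc, not_and, not_le] at hx
    rcases lt_or_ge x 1 with h | h
    · exact Or.inl h
    · right
      rw [Set.mem_ofPred_eq, ← ENNReal.ofReal_natCast]
      refine ENNReal.ofReal_le_ofReal (Real.le_sqrt_of_sq_le ?_)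
      push_cast
      exact (hx h).le
  calc _ ≤ _ := measure_mono hsub
    _ ≤ _ := measure_union_le _ _
    _ = γ {x | ((n + 1 : ℕ) : ℝ≥0∞) ≤ ENNReal.ofReal √x} := by rw [h1, zero_add]
    _ ≤ (∫⁻ x, ENNReal.ofReal √x ∂γ) / (n + 1 : ℕ) :=
        meas_ge_le_lintegral_div (by fun_prop) (by simp) (by simp)
    _ ≤ _ := by gcongr

lemma exists_isRDEFixedPoint {α : ℝ} (hα : α ∈ Set.Ioc (1 : ℝ) 2) :
    ∃ γ : Measure ℝ, IsRDEFixedPoint α γ := by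
  let μ (n : ℕ) : ProbabilityMeasure ℝ := ⟨rdeIter α n, (rdeIter_spec hα n).1⟩
  have hCtop : 1 + ∫⁻ u, ENNReal.ofReal (√u)⁻¹ ∂unifMeasure ≠ ∞ :=
    ENNReal.add_ne_top.2 ⟨by simp, lintegral_inv_sqrt_unifMeasure_ne_top⟩
  lift 1 + ∫⁻ u, ENNReal.ofReal (√u)⁻¹ ∂unifMeasure to ℝ≥0 using hCtop with C hC
  let K (n : ℕ) : Set ℝ := Set.Icc 1 (((n : ℝ) + 1) ^ 2)
  let c (n : ℕ) : ℝ≥0 := C / (n + 1 : ℕ)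
  have hc0 : Tendsto c atTop (𝓝 0) :=
    (tendsto_add_atTop_iff_nat 1).2 (tendsto_const_div_atTop_nhds_zero_nat C)
  have hcomp := isCompact_setOfPred_probabilityMeasure_mass_eq_compl_isCompact_le (K := K) hc0
    (fun n => isCompact_Icc) (Or.inl inferInstance)
  have hmem (n : ℕ) : μ n ∈ {μ : ProbabilityMeasure ℝ | ∀ n, μ (K n)ᶜ ≤ c n} := by
    intro j
    rw [← ENNReal.coe_le_coe, ProbabilityMeasure.ennreal_coeFn_eq_coeFn_toMeasure]
    obtain ⟨_, h1, h2⟩ := rdeIter_spec hα n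
    rw [← hC] at h2
    refine (measure_compl_Icc_le h1 h2 j).trans_eq ?_
    rw [ENNReal.coe_div (by positivity)]
    simp
  obtain ⟨γ, hγ, hlim⟩ := hcomp.ultrafilter_le_nhds ((hyperfilter ℕ).map μ)
    (le_principal_iff.2 (mem_map.2 (univ_mem' hmem)))
  have hlim' : Tendsto μ (hyperfilter ℕ) (𝓝 γ) := hlim
  have hγ1 : (γ : Measure ℝ) (Set.Iio 1) = 0 := by
    rw [← ProbabilityMeasure.ennreal_coeFn_eq_coeFn_toMeasure, ENNReal.coe_eq_zero,
      ← nonpos_iff_eq_zero]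
    refine ge_of_tendsto' hc0 fun n => (ProbabilityMeasure.apply_mono γ ?_).trans (hγ n)
    intro x hx hx'
    exact absurd hx'.1 (not_le.2 hx)
  obtain ⟨D, hD, hCauchy⟩ := exists_wassersteinLE_rdeIter hα
  have hc := contraction_nonneg hα
  have hconv (n : ℕ) : WassersteinLE (rdeIter α n) γ ((1 - α / 8) ^ n * D) := by
    intro L f hf
    obtain ⟨M, hM⟩ := hf.bounded
    have hint : Tendsto (fun m => ∫ x, f x ∂(rdeIter α m)) (hyperfilter ℕ)
        (𝓝 (∫ x, f x ∂(γ : Measure ℝ))) :=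
      ProbabilityMeasure.tendsto_iff_forall_integral_tendsto.1 hlim'
        (BoundedContinuousFunction.ofNormedAddCommGroup f hf.continuous M hM)
    refine le_of_tendsto (hint.const_sub _).abs ?_
    have hge : ∀ᶠ m in (hyperfilter ℕ : Filter ℕ), n ≤ m :=
      Nat.hyperfilter_le_atTop (eventually_ge_atTop n)
    filter_upwards [hge] with m hm using hCauchy n m hm L f hf
  refine ⟨γ, inferInstance, hγ1, ?_⟩
  have := isProbabilityMeasure_rdeMap hα (γ : Measure ℝ)
  have hpow : Tendsto (fun n : ℕ => (1 - α / 8) ^ n * D) atTop (𝓝 0) := by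
    simpa using (tendsto_pow_atTop_nhds_zero_of_lt_one hc (contraction_lt_one hα)).mul_const D
  refine eq_of_integral_isBddLip_eq fun L f hf => ?_
  have hbound (n : ℕ) : |∫ x, f x ∂(rdeMap α γ) - ∫ x, f x ∂(γ : Measure ℝ)|
      ≤ L * ((1 - α / 8) * ((1 - α / 8) ^ n * D)) + L * ((1 - α / 8) ^ (n + 1) * D) := by
    obtain ⟨_, h1, -⟩ := rdeIter_spec hα n
    have h2 := (hconv n).rdeMap hα h1 hγ1 (by positivity) L f hf
    rw [← rdeIter_succ, abs_sub_comm] at h2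
    exact (abs_sub_le _ _ _).trans (add_le_add h2 (hconv (n + 1) L f hf))
  have hzero := ((hpow.const_mul (1 - α / 8)).const_mul L).add
    (((tendsto_add_atTop_iff_nat 1).2 hpow).const_mul L)
  simp only [mul_zero, add_zero] at hzero
  exact sub_eq_zero.1 (abs_nonpos_iff.1 (ge_of_tendsto' hzero hbound))

/-- For every α ∈ (1,2] there is exactly one probability measure on [1,∞) that is a
fixed point of the α-recursive distributional equation. -/
theorem existsUnique_rde_fixed_point (α : ℝ) (hα : α ∈ Set.Ioc (1 : ℝ) 2) :
    ∃! γ : Measure ℝ, IsRDEFixedPoint α γ := by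
  obtain ⟨γ, hγ⟩ := exists_isRDEFixedPoint hα
  exact ⟨γ, hγ, fun ν hν => hν.eq hα hγ⟩
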